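/- Let K be a field of characteristic zero and let d, d' ≥ 1 be integers. Set N = J_d ⊗ id + id ⊗ J_{d'} on K^d ⊗ K^{d'}. Then for every integer k ≥ 0, the dimension of the kernel of N^k equals Σ_{i=1}^{min(d,d')} min(k, d+d'+1-2i). -/

import Mathlib

/-- The nilpotent `n × n` Jordan block over `K`: the `(i+1, i)`-entries are `1`
for `0 ≤ i ≤ n-2` and all other entries are `0`. -/
def jordanBlock (K : Type*) [Field K] (n : ℕ) : Matrix (Fin n) (Fin n) K :=
  Matrix.of fun i j => if (i : ℕ) = (j : ℕ) + 1 then 1 else 0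

/-- The endomorphism `N = J_d ⊗ id + id ⊗ J_{d'}` of `K^d ⊗ K^{d'}`. -/
noncomputable def jordanKroneckerSum (K : Type*) [Field K] (d d' : ℕ) :
    Module.End K (TensorProduct K (Fin d → K) (Fin d' → K)) :=
  TensorProduct.map (Matrix.toLin' (jordanBlock K d)) LinearMap.id +
    TensorProduct.map LinearMap.id (Matrix.toLin' (jordanBlock K d'))

open Polynomial TensorProduct

/-- The Jordan block as an endomorphism. -/
noncomputable def jEnd (K : Type*) [Field K] (n : ℕ) : Module.End K (Fin n → K) :=
  Matrix.toLin' (jordanBlock K n)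

lemma jEnd_zero {K : Type*} [Field K] {n : ℕ} (f : Fin (n + 1) → K) :
    jEnd K (n + 1) f 0 = 0 := by
  simp [jEnd, jordanBlock, Matrix.mulVec, dotProduct]

lemma jEnd_succ {K : Type*} [Field K] {n : ℕ} (f : Fin (n + 1) → K) (i : Fin n) :
    jEnd K (n + 1) f i.succ = f i.castSucc := by
  simp only [jEnd, jordanBlock, Matrix.toLin'_apply, Matrix.mulVec, dotProduct, Matrix.of_apply,
    Fin.val_succ, ite_mul, one_mul, zero_mul]
  rw [Finset.sum_eq_single i.castSucc]
  · simp
  · intro b _ hb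
    rw [if_neg]
    intro h
    apply hb
    ext
    simp
    omega
  · simp

lemma jEnd_apply {K : Type*} [Field K] {n : ℕ} (f : Fin n → K) (i : Fin n) :
    jEnd K n f i = if 1 ≤ (i : ℕ) then f ⟨i - 1, by omega⟩ else 0 := by
  cases n with
  | zero => exact i.elim0
  | succ n =>
    refine Fin.cases ?_ (fun i => ?_) i
    · simp [jEnd_zero]
    · simp [jEnd_succ]; rfl

lemma jEnd_pow_apply {K : Type*} [Field K] {n : ℕ} (k : ℕ) (f : Fin n → K) (i : Fin n) :
    (jEnd K n ^ k) f i = if k ≤ (i : ℕ) then f ⟨i - k, by omega⟩ else 0 := by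
  induction k generalizing i with
  | zero => simp
  | succ k ih =>
    rw [pow_succ', Module.End.mul_apply, jEnd_apply]
    by_cases h : 1 ≤ (i : ℕ)
    · rw [if_pos h, ih]
      by_cases h2 : k + 1 ≤ (i : ℕ)
      · rw [if_pos h2, if_pos (by simp; omega)]
        congr 1
        ext
        simp
        omega
      · rw [if_neg h2, if_neg (by simp; omega)]
    · rw [if_neg h, if_neg (by omega)]

lemma jEnd_pow_self (K : Type*) [Field K] (n : ℕ) : jEnd K n ^ n = 0 := by
  ext1 i
  ext j
  simp [jEnd_pow_apply]

lemma jEnd_pow_single {K : Type*} [Field K] {n : ℕ} (m : Fin (n + 1)) :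
    (jEnd K (n + 1) ^ (m : ℕ)) (Pi.single 0 1) = Pi.single m 1 := by
  ext i
  rw [jEnd_pow_apply]
  simp only [Pi.single_apply, Fin.ext_iff]
  simp
  grind

lemma finrank_ker_jEnd (K : Type*) [Field K] (n k : ℕ) :
    Module.finrank K (LinearMap.ker (jEnd K n ^ k)) = min k n := by
  have hle : n - k ≤ n := Nat.sub_le _ _
  let R : (Fin n → K) →ₗ[K] (Fin (n - k) → K) := LinearMap.funLeft K K (Fin.castLE hle)
  have hR : Function.Surjective R :=
    LinearMap.funLeft_surjective_of_injective K K _ (Fin.castLE_injective hle)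
  have hk : LinearMap.ker (jEnd K n ^ k) = LinearMap.ker R := by
    ext f
    simp only [LinearMap.mem_ker]
    constructor
    · intro h
      ext i
      have := congrFun h ⟨i + k, by omega⟩
      rw [jEnd_pow_apply] at this
      simp only [Nat.le_add_left, if_true, Nat.add_sub_cancel] at this
      exact this
    · intro h
      ext i
      rw [jEnd_pow_apply]
      split_ifs with hi
      · exact congrFun h ⟨i - k, by omega⟩
      · rfl
  rw [hk]
  have h1 := LinearMap.finrank_range_add_finrank_ker R
  rw [LinearMap.range_eq_top.2 hR] at h1
  simp at h1
  omega

/-- Divided power realization of `K^n` by polynomials of degree `< n`. -/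
noncomputable def pEmb (K : Type*) [Field K] (n : ℕ) : (Fin n → K) →ₗ[K] K[X] :=
  ∑ i : Fin n, ((((n - 1 - (i : ℕ)).factorial : K)⁻¹) •
    (Polynomial.monomial (n - 1 - (i : ℕ)))).comp (LinearMap.proj i)

lemma pEmb_apply {K : Type*} [Field K] {n : ℕ} (f : Fin n → K) :
    pEmb K n f = ∑ i : Fin n, Polynomial.monomial (n - 1 - (i : ℕ))
      ((((n - 1 - (i : ℕ)).factorial : K)⁻¹) * f i) := by
  simp [pEmb, Polynomial.smul_monomial]

lemma pEmb_single {K : Type*} [Field K] {n : ℕ} (i : Fin n) :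
    pEmb K n (Pi.single i 1) = Polynomial.monomial (n - 1 - (i : ℕ))
      (((n - 1 - (i : ℕ)).factorial : K)⁻¹) := by
  rw [pEmb_apply, Finset.sum_eq_single i]
  · simp
  · intro b _ hb
    simp [hb]
  · simp

lemma pEmb_injective (K : Type*) [Field K] [CharZero K] (n : ℕ) :
    Function.Injective (pEmb K n) := by
  rw [injective_iff_map_eq_zero]
  intro f hf
  ext i
  have h := congrArg (fun p => p.coeff (n - 1 - (i : ℕ))) hf
  simp only [pEmb_apply, Polynomial.finsetSum_coeff, Polynomial.coeff_monomial,
    Polynomial.coeff_zero] at h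
  rw [Finset.sum_eq_single i] at h
  · simpa [Nat.factorial_ne_zero] using h
  · intro b _ hb
    rw [if_neg]
    intro h
    apply hb
    ext
    omega
  · simp

lemma jEnd_single_castSucc {K : Type*} [Field K] {n : ℕ} (i : Fin n) :
    jEnd K (n + 1) (Pi.single i.castSucc 1) = Pi.single i.succ 1 := by
  ext j
  refine Fin.cases ?_ (fun j => ?_) j
  · simp [jEnd_zero, Pi.single_apply, (Fin.succ_ne_zero i).symm]
  · simp [jEnd_succ, Pi.single_apply]

lemma jEnd_single_last {K : Type*} [Field K] {n : ℕ} :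
    jEnd K (n + 1) (Pi.single (Fin.last n) 1) = 0 := by
  ext j
  refine Fin.cases ?_ (fun j => ?_) j
  · simp [jEnd_zero]
  · simp [jEnd_succ, Pi.single_apply, Fin.castSucc_ne_last]

lemma pEmb_jEnd {K : Type*} [Field K] [CharZero K] {n : ℕ} (f : Fin n → K) :
    pEmb K n (jEnd K n f) = Polynomial.derivative (pEmb K n f) := by
  suffices h : (pEmb K n).comp (jEnd K n) = Polynomial.derivative.comp (pEmb K n) from
    LinearMap.congr_fun h f
  cases n with
  | zero => ext i; exact i.elim0
  | succ n =>
    refine (Pi.basisFun K (Fin (n + 1))).ext fun i => ?_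
    simp only [Pi.basisFun_apply, LinearMap.comp_apply]
    refine Fin.lastCases ?_ (fun i => ?_) i
    · simp [jEnd_single_last, pEmb_single]
    · rw [jEnd_single_castSucc, pEmb_single, pEmb_single, Polynomial.derivative_monomial]
      have h : n + 1 - 1 - (i.castSucc : ℕ) = (n + 1 - 1 - (i.succ : ℕ)) + 1 := by
        simp; omega
      rw [h, Nat.factorial_succ]
      simp only [Nat.add_sub_cancel]
      congr 1
      have : ((n - (i.succ : ℕ) : ℕ) : K) + 1 ≠ 0 := Nat.cast_add_one_ne_zero _
      push_cast
      field_simp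

/-- Inclusion, in polynomial terms. -/
noncomputable def shMap (K : Type*) [Field K] (n : ℕ) : (Fin n → K) →ₗ[K] (Fin (n + 1) → K) :=
  (Pi.basisFun K (Fin n)).constr K fun i => Pi.single i.succ 1

/-- Multiplication by `X`, in polynomial terms. -/
noncomputable def xMap (K : Type*) [Field K] (n : ℕ) : (Fin n → K) →ₗ[K] (Fin (n + 1) → K) :=
  (Pi.basisFun K (Fin n)).constr K fun i => Pi.single i.castSucc ((n - (i : ℕ) : ℕ) : K)

lemma pEmb_shMap {K : Type*} [Field K] {n : ℕ} (f : Fin n → K) :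
    pEmb K (n + 1) (shMap K n f) = pEmb K n f := by
  suffices h : (pEmb K (n + 1)).comp (shMap K n) = pEmb K n from LinearMap.congr_fun h f
  refine (Pi.basisFun K (Fin n)).ext fun i => ?_
  rw [LinearMap.comp_apply, shMap, Module.Basis.constr_basis, Pi.basisFun_apply, pEmb_single,
    pEmb_single]
  have : n + 1 - 1 - (i.succ : ℕ) = n - 1 - i := by simp; omega
  rw [this]

lemma pEmb_xMap {K : Type*} [Field K] [CharZero K] {n : ℕ} (f : Fin n → K) :
    pEmb K (n + 1) (xMap K n f) = X * pEmb K n f := by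
  suffices h : (pEmb K (n + 1)).comp (xMap K n) =
      (LinearMap.mulLeft K (X : K[X])).comp (pEmb K n) from LinearMap.congr_fun h f
  refine (Pi.basisFun K (Fin n)).ext fun i => ?_
  rw [LinearMap.comp_apply, xMap, Module.Basis.constr_basis, Pi.basisFun_apply,
    LinearMap.comp_apply, pEmb_single, LinearMap.mulLeft_apply, Polynomial.X_mul_monomial]
  have h1 : (Pi.single i.castSucc ((n - (i : ℕ) : ℕ) : K) : Fin (n + 1) → K) =
      ((n - (i : ℕ) : ℕ) : K) • Pi.single i.castSucc (1 : K) := by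
    ext j; simp [Pi.single_apply]
  rw [h1, map_smul, pEmb_single, Polynomial.smul_monomial]
  obtain ⟨m, hm⟩ : ∃ m, n - (i : ℕ) = m + 1 := ⟨n - i - 1, by omega⟩
  have h2 : n + 1 - 1 - (i.castSucc : ℕ) = m + 1 := by simp; omega
  have h3 : n - 1 - (i : ℕ) = m := by omega
  rw [h2, h3, hm, Nat.factorial_succ]
  congr 1
  have : (m : K) + 1 ≠ 0 := Nat.cast_add_one_ne_zero _
  push_cast
  rw [smul_eq_mul]
  field_simp

lemma jEnd_shMap {K : Type*} [Field K] [CharZero K] {n : ℕ} (f : Fin n → K) :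
    jEnd K (n + 1) (shMap K n f) = shMap K n (jEnd K n f) := by
  apply pEmb_injective K
  rw [pEmb_jEnd, pEmb_shMap, pEmb_shMap, pEmb_jEnd]

lemma jEnd_xMap {K : Type*} [Field K] [CharZero K] {n : ℕ} (f : Fin n → K) :
    jEnd K (n + 1) (xMap K n f) = xMap K n (jEnd K n f) + shMap K n f := by
  apply pEmb_injective K
  rw [map_add, pEmb_jEnd, pEmb_shMap, pEmb_xMap, pEmb_xMap, pEmb_jEnd, Polynomial.derivative_mul,
    Polynomial.derivative_X]
  ring

lemma jks_tmul {K : Type*} [Field K] {d e : ℕ} (f : Fin d → K) (g : Fin e → K) :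
    jordanKroneckerSum K d e (f ⊗ₜ g) = jEnd K d f ⊗ₜ g + f ⊗ₜ jEnd K e g := by
  simp [jordanKroneckerSum, jEnd]

/-- Multiplication by `X - Y`. -/
noncomputable def phiMap (K : Type*) [Field K] (d e : ℕ) :
    ((Fin d → K) ⊗[K] (Fin e → K)) →ₗ[K] ((Fin (d + 1) → K) ⊗[K] (Fin (e + 1) → K)) :=
  TensorProduct.map (xMap K d) (shMap K e) - TensorProduct.map (shMap K d) (xMap K e)

lemma jks_phi {K : Type*} [Field K] [CharZero K] {d e : ℕ}
    (v : (Fin d → K) ⊗[K] (Fin e → K)) :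
    jordanKroneckerSum K (d + 1) (e + 1) (phiMap K d e v) =
      phiMap K d e (jordanKroneckerSum K d e v) := by
  induction v with
  | zero => simp
  | add x y hx hy => simp only [map_add, hx, hy]
  | tmul f g =>
    simp only [phiMap, LinearMap.sub_apply, TensorProduct.map_tmul, map_sub, jks_tmul, map_add,
      jEnd_shMap, jEnd_xMap, TensorProduct.add_tmul, TensorProduct.tmul_add]
    abel

/-- Realization by polynomials in two variables. -/
noncomputable def ppEmb (K : Type*) [Field K] (d e : ℕ) :
    ((Fin d → K) ⊗[K] (Fin e → K)) →ₗ[K] (K[X] ⊗[K] K[X]) :=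
  TensorProduct.map (pEmb K d) (pEmb K e)

lemma ppEmb_injective (K : Type*) [Field K] [CharZero K] (d e : ℕ) :
    Function.Injective (ppEmb K d e) :=
  TensorProduct.map_injective_of_flat_flat _ _ (pEmb_injective K d) (pEmb_injective K e)

lemma ppEmb_phi {K : Type*} [Field K] [CharZero K] {d e : ℕ}
    (v : (Fin d → K) ⊗[K] (Fin e → K)) :
    ppEmb K (d + 1) (e + 1) (phiMap K d e v) =
      ((X : K[X]) ⊗ₜ[K] (1 : K[X]) - (1 : K[X]) ⊗ₜ[K] (X : K[X])) * ppEmb K d e v := by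
  induction v with
  | zero => simp
  | add x y hx hy => simp only [map_add, hx, hy, mul_add]
  | tmul f g =>
    simp [phiMap, ppEmb, pEmb_xMap, pEmb_shMap, sub_mul]

lemma phi_injective (K : Type*) [Field K] [CharZero K] (d e : ℕ) :
    Function.Injective (phiMap K d e) := by
  rw [injective_iff_map_eq_zero]
  intro v hv
  have h := ppEmb_phi v
  rw [hv, map_zero] at h
  have h2 := congrArg (polyEquivTensor K K[X]).symm h.symm
  rw [map_mul, map_zero, map_sub, polyEquivTensor_symm_apply_tmul_eq_smul,
    polyEquivTensor_symm_apply_tmul_eq_smul] at h2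
  rcases mul_eq_zero.1 h2 with h3 | h3
  · exfalso
    have := congrArg (fun p => Polynomial.coeff p 1) h3
    simp [Polynomial.coeff_one] at this
  · apply ppEmb_injective K
    rw [map_zero]
    exact (map_eq_zero_iff _ (polyEquivTensor K K[X]).symm.injective).1 h3

/-- Restriction to the diagonal. -/
noncomputable def psiMap (K : Type*) [Field K] (d e : ℕ) :
    ((Fin d → K) ⊗[K] (Fin e → K)) →ₗ[K] K[X] :=
  (LinearMap.mul' K K[X]).comp (ppEmb K d e)

lemma psi_phi {K : Type*} [Field K] [CharZero K] {d e : ℕ}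
    (v : (Fin d → K) ⊗[K] (Fin e → K)) :
    psiMap K (d + 1) (e + 1) (phiMap K d e v) = 0 := by
  induction v with
  | zero => simp
  | add x y hx hy => simp only [map_add, hx, hy, add_zero]
  | tmul f g =>
    simp [psiMap, phiMap, ppEmb, pEmb_xMap, pEmb_shMap]
    ring

lemma psi_jks {K : Type*} [Field K] [CharZero K] {d e : ℕ}
    (v : (Fin d → K) ⊗[K] (Fin e → K)) :
    psiMap K d e (jordanKroneckerSum K d e v) = Polynomial.derivative (psiMap K d e v) := by
  induction v with
  | zero => simp
  | add x y hx hy => simp only [map_add, hx, hy]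
  | tmul f g =>
    simp [psiMap, ppEmb, jks_tmul, pEmb_jEnd, Polynomial.derivative_mul]

lemma jks_pow {K : Type*} [Field K] {d e : ℕ} :
    jordanKroneckerSum K (d + 1) (e + 1) ^ (d + e + 1) = 0 := by
  have hc : Commute (TensorProduct.map (jEnd K (d + 1)) (LinearMap.id : Module.End K (Fin (e + 1) → K)))
      (TensorProduct.map (LinearMap.id : Module.End K (Fin (d + 1) → K)) (jEnd K (e + 1))) := by
    apply TensorProduct.ext'
    intro x y
    simp
  refine Commute.add_pow_eq_zero_of_add_le_succ_of_pow_eq_zero (m := d + 1) (n := e + 1) hc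
    ?_ ?_ (by omega)
  · change TensorProduct.map (jEnd K (d + 1)) _ ^ _ = 0
    rw [← Module.End.one_eq_id, TensorProduct.map_pow, jEnd_pow_self, TensorProduct.map_zero_left]
  · change TensorProduct.map _ (jEnd K (e + 1)) ^ _ = 0
    rw [← Module.End.one_eq_id, TensorProduct.map_pow, jEnd_pow_self, TensorProduct.map_zero_right]

/-- The cyclic vector. -/
noncomputable def wVec (K : Type*) [Field K] (d e : ℕ) :
    (Fin (d + 1) → K) ⊗[K] (Fin (e + 1) → K) :=
  Pi.single 0 1 ⊗ₜ Pi.single 0 1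

/-- The top Jordan block. -/
noncomputable def sigMap (K : Type*) [Field K] (d e : ℕ) :
    (Fin (d + e + 1) → K) →ₗ[K] ((Fin (d + 1) → K) ⊗[K] (Fin (e + 1) → K)) :=
  (Pi.basisFun K (Fin (d + e + 1))).constr K fun m =>
    (jordanKroneckerSum K (d + 1) (e + 1) ^ (m : ℕ)) (wVec K d e)

lemma sig_single {K : Type*} [Field K] {d e : ℕ} (m : Fin (d + e + 1)) :
    sigMap K d e (Pi.single m 1) =
      (jordanKroneckerSum K (d + 1) (e + 1) ^ (m : ℕ)) (wVec K d e) := by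
  rw [← Pi.basisFun_apply, sigMap, Module.Basis.constr_basis]

lemma jks_sig {K : Type*} [Field K] {d e : ℕ} (f : Fin (d + e + 1) → K) :
    jordanKroneckerSum K (d + 1) (e + 1) (sigMap K d e f) =
      sigMap K d e (jEnd K (d + e + 1) f) := by
  suffices h : (jordanKroneckerSum K (d + 1) (e + 1)).comp (sigMap K d e) =
    (sigMap K d e).comp (jEnd K (d + e + 1)) from LinearMap.congr_fun h f
  refine (Pi.basisFun K (Fin (d + e + 1))).ext fun i => ?_
  simp only [Pi.basisFun_apply, LinearMap.comp_apply]
  rw [sig_single, ← Module.End.mul_apply, ← pow_succ']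
  refine Fin.lastCases ?_ (fun i => ?_) i
  · rw [jEnd_single_last, Fin.val_last, jks_pow]
    simp
  · rw [jEnd_single_castSucc, sig_single]
    simp

lemma psi_jks_pow {K : Type*} [Field K] [CharZero K] {d e : ℕ} (m : ℕ)
    (v : (Fin d → K) ⊗[K] (Fin e → K)) :
    psiMap K d e ((jordanKroneckerSum K d e ^ m) v) =
      (Polynomial.derivative ^ m : Module.End K K[X]) (psiMap K d e v) := by
  induction m with
  | zero => simp
  | succ m ih => rw [pow_succ', pow_succ', Module.End.mul_apply, psi_jks, ih]; rfl

lemma pEmb_jEnd_pow {K : Type*} [Field K] [CharZero K] {n : ℕ} (m : ℕ) (f : Fin n → K) :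
    pEmb K n ((jEnd K n ^ m) f) =
      (Polynomial.derivative ^ m : Module.End K K[X]) (pEmb K n f) := by
  induction m with
  | zero => simp
  | succ m ih => rw [pow_succ', pow_succ', Module.End.mul_apply, pEmb_jEnd, ih]; rfl

lemma psi_sig (K : Type*) [Field K] [CharZero K] (d e : ℕ) :
    ∃ c : K, c ≠ 0 ∧ ∀ f, psiMap K (d + 1) (e + 1) (sigMap K d e f) =
      c • pEmb K (d + e + 1) f := by
  refine ⟨(d.factorial : K)⁻¹ * (e.factorial : K)⁻¹ * ((d + e).factorial : K), ?_, fun f => ?_⟩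
  · simp [Nat.factorial_ne_zero]
  set c := (d.factorial : K)⁻¹ * (e.factorial : K)⁻¹ * ((d + e).factorial : K) with hc
  suffices h : (psiMap K (d + 1) (e + 1)).comp (sigMap K d e) =
    c • pEmb K (d + e + 1) from LinearMap.congr_fun h f
  have hw : psiMap K (d + 1) (e + 1) (wVec K d e) =
      c • pEmb K (d + e + 1) (Pi.single 0 1) := by
    simp only [psiMap, wVec, ppEmb, LinearMap.comp_apply, TensorProduct.map_tmul,
      LinearMap.mul'_apply, pEmb_single, Polynomial.monomial_mul_monomial,
      Polynomial.smul_monomial]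
    simp [hc, Nat.factorial_ne_zero]
  refine (Pi.basisFun K (Fin (d + e + 1))).ext fun i => ?_
  simp only [Pi.basisFun_apply, LinearMap.comp_apply, LinearMap.smul_apply]
  rw [sig_single, psi_jks_pow, hw, map_smul, ← pEmb_jEnd_pow, jEnd_pow_single]

/-- The product of submodules as a module. -/
def subProdEquiv {K V W : Type*} [Field K] [AddCommGroup V] [Module K V] [AddCommGroup W]
    [Module K W] (A : Submodule K V) (B : Submodule K W) : A.prod B ≃ₗ[K] A × B where
  toFun x := (⟨x.1.1, x.2.1⟩, ⟨x.1.2, x.2.2⟩)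
  invFun y := ⟨(y.1.1, y.2.1), ⟨y.1.2, y.2.2⟩⟩
  map_add' _ _ := rfl
  map_smul' _ _ := rfl
  left_inv _ := rfl
  right_inv _ := rfl

lemma finrank_subProd {K V W : Type*} [Field K] [AddCommGroup V] [Module K V] [AddCommGroup W]
    [Module K W] [Module.Finite K V] [Module.Finite K W] (A : Submodule K V) (B : Submodule K W) :
    Module.finrank K (A.prod B) = Module.finrank K A + Module.finrank K B := by
  rw [← Module.finrank_prod]
  exact LinearEquiv.finrank_eq (subProdEquiv A B)

lemma finrank_rec (K : Type*) [Field K] [CharZero K] (d e k : ℕ) :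
    Module.finrank K (LinearMap.ker (jordanKroneckerSum K (d + 1) (e + 1) ^ k)) =
      Module.finrank K (LinearMap.ker (jordanKroneckerSum K d e ^ k)) + min k (d + e + 1) := by
  let T := (phiMap K d e).coprod (sigMap K d e)
  have hT : Function.Injective T := by
    rw [injective_iff_map_eq_zero]
    rintro ⟨v, p⟩ h
    simp only [T, LinearMap.coprod_apply] at h
    obtain ⟨c, hc, hs⟩ := psi_sig K d e
    have h2 := congrArg (psiMap K (d + 1) (e + 1)) h
    rw [map_add, psi_phi, hs, map_zero, zero_add, smul_eq_zero_iff_right hc] at h2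
    have hp : p = 0 := pEmb_injective K _ (by rw [h2, map_zero])
    subst hp
    rw [map_zero, add_zero] at h
    have hv : v = 0 := phi_injective K d e (by rw [h, map_zero])
    rw [hv]; rfl
  have hdim : Module.finrank K (((Fin d → K) ⊗[K] (Fin e → K)) × (Fin (d + e + 1) → K)) =
      Module.finrank K ((Fin (d + 1) → K) ⊗[K] (Fin (e + 1) → K)) := by
    simp
    ring
  let E := LinearEquiv.ofInjectiveOfFinrankEq T hT hdim
  have hE : ∀ x, E x = T x := fun x => rfl
  have hint : ∀ (k : ℕ) v p, (jordanKroneckerSum K (d + 1) (e + 1) ^ k) (T (v, p)) =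
      T ((jordanKroneckerSum K d e ^ k) v, (jEnd K (d + e + 1) ^ k) p) := by
    intro k
    induction k with
    | zero => simp
    | succ k ih =>
      intro v p
      rw [pow_succ', Module.End.mul_apply, ih]
      simp only [T, LinearMap.coprod_apply, map_add, jks_phi, jks_sig, pow_succ',
        Module.End.mul_apply]
  have hker : (LinearMap.ker (jordanKroneckerSum K (d + 1) (e + 1) ^ k)) =
      ((LinearMap.ker (jordanKroneckerSum K d e ^ k)).prod
        (LinearMap.ker (jEnd K (d + e + 1) ^ k))).map E.toLinearMap := by
    ext x
    obtain ⟨⟨v, p⟩, rfl⟩ := E.surjective x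
    rw [LinearMap.mem_ker, hE, hint, map_eq_zero_iff T hT, ← hE]
    constructor
    · intro h
      exact ⟨(v, p), ⟨(Prod.ext_iff.1 h).1, (Prod.ext_iff.1 h).2⟩, rfl⟩
    · rintro ⟨y, hy, hxy⟩
      have : y = (v, p) := E.injective hxy
      subst this
      exact Prod.ext hy.1 hy.2
  rw [hker, LinearEquiv.finrank_map_eq, ← finrank_ker_jEnd K]
  exact finrank_subProd _ _

lemma finrank_all (K : Type*) [Field K] [CharZero K] (k d e : ℕ) :
    Module.finrank K (LinearMap.ker (jordanKroneckerSum K d e ^ k)) =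
      ∑ i ∈ Finset.range (min d e), min k (d + e - 1 - 2 * i) := by
  induction d generalizing e with
  | zero =>
    have : Module.finrank K ((Fin 0 → K) ⊗[K] (Fin e → K)) = 0 := by simp
    have h := Submodule.finrank_le (LinearMap.ker (jordanKroneckerSum K 0 e ^ k))
    rw [Nat.zero_min, Finset.range_zero, Finset.sum_empty]
    exact Nat.le_zero.1 (h.trans this.le)
  | succ d ih =>
    cases e with
    | zero =>
      have : Module.finrank K ((Fin (d + 1) → K) ⊗[K] (Fin 0 → K)) = 0 := by simp
      have h := Submodule.finrank_le (LinearMap.ker (jordanKroneckerSum K (d + 1) 0 ^ k))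
      rw [Nat.min_zero, Finset.range_zero, Finset.sum_empty]
      exact Nat.le_zero.1 (h.trans this.le)
    | succ e =>
      rw [finrank_rec, ih, Nat.succ_min_succ, Finset.sum_range_succ']
      congr 1
      · refine Finset.sum_congr rfl fun i _ => ?_
        congr 1
        omega
      · congr 1
        omega

/-- For a field `K` of characteristic zero, integers `d, d' ≥ 1` and
`N = J_d ⊗ id + id ⊗ J_{d'}` on `K^d ⊗ K^{d'}`, for every integer `k ≥ 0` the dimension
of the kernel of `N^k` equals `Σ_{i=1}^{min(d,d')} min(k, d + d' + 1 - 2i)` (written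
below with the `0`-based summation index `i ∈ {0, …, min d d' - 1}`). -/
theorem finrank_ker_pow_jordanKroneckerSum
    (K : Type*) [Field K] [CharZero K] (d d' : ℕ) (hd : 1 ≤ d) (hd' : 1 ≤ d')
    (k : ℕ) :
    Module.finrank K (LinearMap.ker (jordanKroneckerSum K d d' ^ k)) =
      ∑ i ∈ Finset.range (min d d'), min k (d + d' - 1 - 2 * i) :=
  finrank_all K k d d'
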